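/- Exponential strong converse under total variation: for every rate R < C_Wyner(X;Y) there exists a constant c > 0 such that for every sequence of synthesis codes of rate R, the total variation distance satisfies |P_{X^nY^n} − π_{X^nY^n}| ≥ 1 − 4e^{−cn} for all n; in particular |P_{X^nY^n} − π_{X^nY^n}| tends to one exponentially fast as n → ∞. -/

import Mathlib

open Filter

noncomputable section

/-- `P` is a probability mass function on the finite type `α`. -/
def IsPMF {α : Type*} [Fintype α] (P : α → ℝ) : Prop :=
  (∀ a, 0 ≤ P a) ∧ (∑ a, P a) = 1

/-- Rényi divergence of order `1 + s` (natural logarithm), `EReal`-valued.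
For `s ≥ 0` it is `⊤` when `supp P ⊄ supp Q`; for `s = 0` it is the relative
entropy; otherwise it is `(1/s) log ∑_{x ∈ supp P} P(x)^{1+s} Q(x)^{-s}`. -/
def renyiDiv {α : Type*} [Fintype α] (s : ℝ) (P Q : α → ℝ) : EReal :=
  if 0 ≤ s ∧ ∃ a, 0 < P a ∧ Q a = 0 then ⊤
  else if s = 0 then
    (((∑ a ∈ Finset.univ.filter (fun a => 0 < P a), P a * Real.log (P a / Q a)) : ℝ) : EReal)
  else
    ((((1 / s) * Real.log (∑ a ∈ Finset.univ.filter (fun a => 0 < P a),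
        P a ^ (1 + s) * Q a ^ (-s))) : ℝ) : EReal)

/-- Mutual information `I(XY; W)` of a joint distribution on `(X × Y) × W`. -/
def mutualInfoW {X Y W : Type*} [Fintype X] [Fintype Y] [Fintype W] (P : X × Y × W → ℝ) : ℝ :=
  ∑ z ∈ Finset.univ.filter (fun z : X × Y × W => 0 < P z),
    P z * Real.log (P z /
      ((∑ w, P (z.1, z.2.1, w)) * (∑ p : X × Y, P (p.1, p.2, z.2.2))))

/-- The Markov chain condition `X − W − Y`. -/
def IsMarkovXWY {X Y W : Type*} [Fintype X] [Fintype Y] [Fintype W] (P : X × Y × W → ℝ) : Prop :=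
  ∀ x y w, P (x, y, w) * (∑ p : X × Y, P (p.1, p.2, w)) =
    (∑ y', P (x, y', w)) * (∑ x', P (x', y, w))

/-- Wyner's common information of the target distribution `π` on `X × Y`. -/
def CWyner {X Y : Type*} [Fintype X] [Fintype Y] (π : X × Y → ℝ) : ℝ :=
  sInf { r | ∃ P : X × Y × Fin (Fintype.card X * Fintype.card Y) → ℝ,
    IsPMF P ∧ (∀ x y, (∑ w, P (x, y, w)) = π (x, y)) ∧ IsMarkovXWY P ∧ r = mutualInfoW P }

/-- The message set size `⌈e^{nR}⌉` of a rate-`R` synthesis code at blocklength `n`. -/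
def numMsgs (R : ℝ) (n : ℕ) : ℕ := ⌈Real.exp (n * R)⌉₊

/-- A synthesis code: a pair of conditional distributions from the message set to
`X^n` and `Y^n` respectively. -/
structure SynthCode (X Y : Type*) [Fintype X] [Fintype Y] (M n : ℕ) where
  PX : Fin M → (Fin n → X) → ℝ
  PY : Fin M → (Fin n → Y) → ℝ
  PX_pmf : ∀ m, IsPMF (PX m)
  PY_pmf : ∀ m, IsPMF (PY m)

/-- The distribution `P_{X^n Y^n}` induced by a synthesis code. -/
def SynthCode.induced {X Y : Type*} [Fintype X] [Fintype Y] {M n : ℕ}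
    (c : SynthCode X Y M n) : (Fin n → X) × (Fin n → Y) → ℝ :=
  fun z => (M : ℝ)⁻¹ * ∑ m, c.PX m z.1 * c.PY m z.2

/-- The `n`-fold product distribution `π^{⊗ n}` on `X^n × Y^n`. -/
def prodDist {X Y : Type*} [Fintype X] [Fintype Y] (π : X × Y → ℝ) (n : ℕ) :
    (Fin n → X) × (Fin n → Y) → ℝ :=
  fun z => ∏ i, π (z.1 i, z.2 i)

/-- Total variation distance between two distributions on a finite type. -/
def tvDist {α : Type*} [Fintype α] (P Q : α → ℝ) : ℝ :=
  (∑ a, |P a - Q a|) / 2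

/-- Shannon entropy. -/
def shannonEntropy {α : Type*} [Fintype α] (v : α → ℝ) : ℝ := ∑ a, Real.negMulLog (v a)

/-- The product distributions on `X × Y`. -/
def productPMFs (X Y : Type*) [Fintype X] [Fintype Y] : Set (X × Y → ℝ) :=
  {v | ∃ (q : X → ℝ) (r : Y → ℝ), IsPMF q ∧ IsPMF r ∧ v = fun z => q z.1 * r z.2}

lemma IsPMF.le_one {α : Type*} [Fintype α] {P : α → ℝ} (h : IsPMF P) (a : α) : P a ≤ 1 :=
  h.2 ▸ Finset.single_le_sum (fun b _ => h.1 b) (Finset.mem_univ a)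

lemma isPMF_of_mem_productPMFs {X Y : Type*} [Fintype X] [Fintype Y] {v : X × Y → ℝ}
    (hv : v ∈ productPMFs X Y) : IsPMF v := by
  obtain ⟨q, r, hq, hr, rfl⟩ := hv
  refine ⟨fun z => mul_nonneg (hq.1 _) (hr.1 _), ?_⟩
  rw [Fintype.sum_prod_type]
  simp only [← Finset.mul_sum, hr.2, mul_one, hq.2]

lemma neg_one_le_mul_log_div {p a b : ℝ} (hp : 0 < p) (ha : p ≤ a) (hb : p ≤ b) (ha1 : a ≤ 1)
    (hb1 : b ≤ 1) : -1 ≤ p * Real.log (p / (a * b)) := by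
  have ha0 := hp.trans_le ha
  have hb0 := hp.trans_le hb
  have hpos : 0 < p / (a * b) := by positivity
  have h1 := Real.one_sub_inv_le_log_of_pos hpos
  have h2 : p * (1 - (p / (a * b))⁻¹) = p - a * b := by field_simp
  have h3 := mul_le_mul_of_nonneg_left h1 hp.le
  nlinarith

lemma neg_card_le_mutualInfoW {X Y W : Type*} [Fintype X] [Fintype Y] [Fintype W]
    {P : X × Y × W → ℝ} (hP : IsPMF P) :
    -(Fintype.card (X × Y × W) : ℝ) ≤ mutualInfoW P := by
  classical
  have hmarg : ∀ x y, ∑ w, P (x, y, w) ≤ 1 := fun x y => by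
    rw [← hP.2, Fintype.sum_prod_type]
    simp only [Fintype.sum_prod_type]
    refine le_trans ?_ (Finset.single_le_sum (f := fun x => ∑ y, ∑ w, P (x, y, w))
      (fun x _ => Finset.sum_nonneg fun y _ => Finset.sum_nonneg fun w _ => hP.1 _)
      (Finset.mem_univ x))
    exact Finset.single_le_sum (f := fun y => ∑ w, P (x, y, w))
      (fun y _ => Finset.sum_nonneg fun w _ => hP.1 _) (Finset.mem_univ y)
  have hW : ∀ w, ∑ p : X × Y, P (p.1, p.2, w) ≤ 1 := fun w => by
    have : ∑ z, P z = ∑ p : X × Y, ∑ w, P (p.1, p.2, w) := by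
      simp only [Fintype.sum_prod_type]
    rw [← hP.2, this]
    exact Finset.sum_le_sum fun p _ =>
      Finset.single_le_sum (f := fun w => P (p.1, p.2, w)) (fun w _ => hP.1 _) (Finset.mem_univ w)
  unfold mutualInfoW
  calc -(Fintype.card (X × Y × W) : ℝ)
      ≤ -((Finset.univ.filter (fun z : X × Y × W => 0 < P z)).card : ℝ) := by
        gcongr
        exact Finset.card_le_univ _
    _ = ∑ z ∈ Finset.univ.filter (fun z : X × Y × W => 0 < P z), (-1 : ℝ) := by simp
    _ ≤ _ := by
      refine Finset.sum_le_sum fun z hz => ?_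
      refine neg_one_le_mul_log_div (Finset.mem_filter.1 hz).2 ?_ ?_ (hmarg _ _) (hW _)
      · exact Finset.single_le_sum (f := fun w => P (z.1, z.2.1, w)) (fun w _ => hP.1 _)
          (Finset.mem_univ z.2.2)
      · exact Finset.single_le_sum (f := fun p : X × Y => P (p.1, p.2, z.2.2)) (fun w _ => hP.1 _)
          (Finset.mem_univ (z.1, z.2.1))

lemma CWyner_le_sub {X Y : Type*} [Fintype X] [Fintype Y] {π : X × Y → ℝ} (hπ : IsPMF π)
    (p : Fin (Fintype.card X * Fintype.card Y) → ℝ)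
    (v : Fin (Fintype.card X * Fintype.card Y) → X × Y → ℝ)
    (hp : ∀ k, 0 ≤ p k) (hv : ∀ k, v k ∈ productPMFs X Y) (hsum : ∑ k, p k • v k = π) :
    CWyner π ≤ shannonEntropy π - ∑ k, p k * shannonEntropy (v k) := by
  have hpm := fun k => isPMF_of_mem_productPMFs (hv k)
  choose q r hq hr hqr using hv
  set P : X × Y × Fin (Fintype.card X * Fintype.card Y) → ℝ :=
    fun z => p z.2.2 * v z.2.2 (z.1, z.2.1) with hPdef
  have hmarg : ∀ x y, ∑ w, P (x, y, w) = π (x, y) := fun x y => by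
    rw [← hsum]; simp [hPdef]
  have hW : ∀ w, ∑ z : X × Y, P (z.1, z.2, w) = p w := fun w => by
    simp only [hPdef, Prod.mk.eta, ← Finset.mul_sum, (hpm w).2, mul_one]
  have hP : IsPMF P := by
    refine ⟨fun z => mul_nonneg (hp _) ((hpm _).1 _), ?_⟩
    rw [← hπ.2]
    simp only [Fintype.sum_prod_type, hmarg]
  refine csInf_le ⟨-(Fintype.card (X × Y × Fin (Fintype.card X * Fintype.card Y)) : ℝ), ?_⟩
    ⟨P, hP, hmarg, ?_, ?_⟩
  · rintro _ ⟨Q, hQ, -, -, rfl⟩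
    exact neg_card_le_mutualInfoW hQ
  · intro x y w
    rw [hW]
    simp only [hPdef, hqr, ← Finset.mul_sum, ← Finset.sum_mul, (hq w).2, (hr w).2]
    ring
  · have hterm : ∀ z : X × Y × Fin (Fintype.card X * Fintype.card Y),
        (if 0 < P z then P z * Real.log (P z /
          ((∑ w, P (z.1, z.2.1, w)) * (∑ p : X × Y, P (p.1, p.2, z.2.2)))) else 0) =
        -(P z * Real.log (π (z.1, z.2.1))) - p z.2.2 * Real.negMulLog (v z.2.2 (z.1, z.2.1)) := by
      rintro ⟨x, y, w⟩
      simp only [hW, hmarg]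
      rcases (hP.1 (x, y, w)).lt_or_eq with h | h
      · have h1 : 0 < p w := (hp w).lt_of_ne fun h0 => by simp [hPdef, ← h0] at h
        have h2 : 0 < v w (x, y) := ((hpm w).1 _).lt_of_ne fun h0 => by simp [hPdef, ← h0] at h
        have h3 : 0 < π (x, y) := by
          rw [← hmarg]
          exact h.trans_le (Finset.single_le_sum (f := fun w => P (x, y, w)) (fun w _ => hP.1 _)
            (Finset.mem_univ w))
        rw [if_pos h]
        have : P (x, y, w) / (π (x, y) * p w) = v w (x, y) / π (x, y) := by
          simp only [hPdef]; field_simp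
        rw [this, Real.log_div h2.ne' h3.ne', Real.negMulLog]
        simp only [hPdef]; ring
      · rw [if_neg h.not_lt, ← h]
        have : p w = 0 ∨ v w (x, y) = 0 := mul_eq_zero.1 h.symm
        rcases this with h | h <;> simp [h]
    unfold mutualInfoW
    rw [Finset.sum_filter, Finset.sum_congr rfl fun z _ => hterm z, Finset.sum_sub_distrib]
    congr 1
    · unfold shannonEntropy
      simp only [Fintype.sum_prod_type, Finset.sum_neg_distrib, ← Finset.sum_mul, hmarg,
        Real.negMulLog, neg_mul]
    · simp only [shannonEntropy, Finset.mul_sum]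
      rw [Finset.sum_comm, Fintype.sum_prod_type, Fintype.sum_prod_type]
      simp only [Fintype.sum_prod_type]

/-- Pairs `(v, s)` such that `v` is a mixture of `N` product distributions whose average entropy
is at least `s`. -/
def mixtureHypograph (X Y : Type*) [Fintype X] [Fintype Y] (N : ℕ) : Set ((X × Y → ℝ) × ℝ) :=
  {a | ∃ (w : Fin N → ℝ) (u : Fin N → X × Y → ℝ), (∀ k, 0 ≤ w k) ∧ ∑ k, w k = 1 ∧
    (∀ k, u k ∈ productPMFs X Y) ∧ ∑ k, w k • u k = a.1 ∧ a.2 ≤ ∑ k, w k * shannonEntropy (u k)}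

lemma exists_nonneg_add_mul_eq_zero {ι : Type*} [Fintype ι] (w g : ι → ℝ) (hw : ∀ k, 0 ≤ w k)
    (hg : ∃ i, g i < 0) : ∃ τ : ℝ, 0 ≤ τ ∧ (∀ k, 0 ≤ w k + τ * g k) ∧ ∃ i, w i + τ * g i = 0 := by
  classical
  obtain ⟨i, hi⟩ := hg
  obtain ⟨j, hj, hmin⟩ := Finset.exists_min_image (Finset.univ.filter fun i => g i < 0)
    (fun i => w i / -g i) ⟨i, by simpa using hi⟩
  have hj' : g j < 0 := by simpa using hj
  refine ⟨w j / -g j, div_nonneg (hw j) (by linarith), fun k => ?_, j, ?_⟩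
  · by_cases hk : g k < 0
    · have h := hmin k (by simpa using hk)
      rw [le_div_iff₀ (by linarith)] at h
      linarith
    · have : 0 ≤ w j / -g j := div_nonneg (hw j) (by linarith)
      have := mul_nonneg this (not_lt.1 hk)
      linarith [hw k]
  · have : g j ≠ 0 := hj'.ne
    field_simp
    ring

lemma sum_succAbove_add_mul_smul {E : Type*} [AddCommGroup E] [Module ℝ E] {N : ℕ}
    {w g : Fin (N + 1) → ℝ} {τ : ℝ} {j : Fin (N + 1)} (hj : w j + τ * g j = 0)
    (f : Fin (N + 1) → E) :
    ∑ k : Fin N, (w (j.succAbove k) + τ * g (j.succAbove k)) • f (j.succAbove k) =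
      ∑ k, w k • f k + τ • ∑ k, g k • f k := by
  have := Fin.sum_univ_succAbove (fun k => (w k + τ * g k) • f k) j
  simp only [hj, zero_smul, zero_add] at this
  rw [← this]
  simp [add_smul, Finset.sum_add_distrib, Finset.smul_sum, mul_smul]

lemma mixtureHypograph_succ_subset {X Y : Type*} [Fintype X] [Fintype Y] {N : ℕ}
    (hN : Fintype.card X * Fintype.card Y ≤ N) :
    mixtureHypograph X Y (N + 1) ⊆ mixtureHypograph X Y N := by
  rintro a ⟨w, u, hw, hw1, hu, hsum, hent⟩
  have hdep : ¬ LinearIndependent ℝ u := fun h => by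
    have := h.fintype_card_le_finrank
    simp only [Fintype.card_fin, Module.finrank_fintype_fun_eq_card, Fintype.card_prod] at this
    omega
  obtain ⟨g, hg0, hgh, i, hgi⟩ : ∃ g : Fin (N + 1) → ℝ, ∑ k, g k • u k = 0 ∧
      0 ≤ ∑ k, g k * shannonEntropy (u k) ∧ ∃ i, g i ≠ 0 := by
    rw [Fintype.linearIndependent_iff] at hdep
    push Not at hdep
    obtain ⟨g, hg, i, hi⟩ := hdep
    rcases le_total 0 (∑ k, g k * shannonEntropy (u k)) with h | h
    · exact ⟨g, hg, h, i, hi⟩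
    · exact ⟨-g, by simp [hg], by simpa using h, i, by simpa using hi⟩
  have hgs : ∑ k, g k = 0 := by
    have h : ∑ z, (∑ k, g k • u k) z = 0 := by rw [hg0]; simp
    simp only [Finset.sum_apply, Pi.smul_apply, smul_eq_mul] at h
    rw [Finset.sum_comm] at h
    simpa [← Finset.mul_sum, fun k => (isPMF_of_mem_productPMFs (hu k)).2] using h
  have hneg : ∃ i, g i < 0 := by
    by_contra! h
    exact hgi ((Finset.sum_eq_zero_iff_of_nonneg fun k _ => h k).1 hgs i (Finset.mem_univ i))
  obtain ⟨τ, hτ, hnn, j, hj⟩ := exists_nonneg_add_mul_eq_zero w g hw hneg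
  refine ⟨fun k => w (j.succAbove k) + τ * g (j.succAbove k), fun k => u (j.succAbove k),
    fun k => hnn _, ?_, fun k => hu _, ?_, ?_⟩
  · have h := sum_succAbove_add_mul_smul hj (fun _ => (1 : ℝ))
    simpa [hw1, hgs] using h
  · have h := sum_succAbove_add_mul_smul hj u
    rwa [hg0, hsum, smul_zero, add_zero] at h
  · have h := sum_succAbove_add_mul_smul hj (fun k => shannonEntropy (u k))
    simp only [smul_eq_mul] at h
    rw [h]
    nlinarith [mul_nonneg hτ hgh]

lemma mixtureHypograph_add_subset {X Y : Type*} [Fintype X] [Fintype Y] (m : ℕ) :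
    mixtureHypograph X Y (Fintype.card X * Fintype.card Y + m) ⊆
      mixtureHypograph X Y (Fintype.card X * Fintype.card Y) := by
  induction m with
  | zero => exact subset_rfl
  | succ m ih => exact (mixtureHypograph_succ_subset (Nat.le_add_right _ _)).trans ih

lemma convex_mixtureHypograph (X Y : Type*) [Fintype X] [Fintype Y] :
    Convex ℝ (mixtureHypograph X Y (Fintype.card X * Fintype.card Y)) := by
  rintro a ⟨w, u, hw, hw1, hu, hsum, hent⟩ a' ⟨w', u', hw', hw1', hu', hsum', hent'⟩ s t hs ht hst
  refine mixtureHypograph_add_subset _ ⟨Fin.append (fun k => s * w k) (fun k => t * w' k),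
    Fin.append u u', fun k => ?_, ?_, fun k => ?_, ?_, ?_⟩
  · refine Fin.addCases (fun k => ?_) (fun k => ?_) k
    · simpa using mul_nonneg hs (hw k)
    · simpa [-Fin.natAdd_eq_addNat] using mul_nonneg ht (hw' k)
  · simp [-Fin.natAdd_eq_addNat, Fin.sum_univ_add, ← Finset.mul_sum, hw1, hw1', hst]
  · refine Fin.addCases (fun k => ?_) (fun k => ?_) k
    · simpa using hu k
    · simpa [-Fin.natAdd_eq_addNat] using hu' k
  · simp [-Fin.natAdd_eq_addNat, Fin.sum_univ_add, mul_smul, ← Finset.smul_sum, hsum, hsum']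
  · simp only [Fin.sum_univ_add, Fin.append_left, Fin.append_right, mul_assoc, ← Finset.mul_sum,
      Prod.snd_add, Prod.smul_snd, smul_eq_mul]
    gcongr

lemma continuous_shannonEntropy {α : Type*} [Fintype α] :
    Continuous (shannonEntropy : (α → ℝ) → ℝ) :=
  continuous_finsetSum _ fun a _ => Real.continuous_negMulLog.comp (continuous_apply a)

lemma isCompact_productPMFs (X Y : Type*) [Fintype X] [Fintype Y] :
    IsCompact (productPMFs X Y) := by
  convert ((isCompact_stdSimplex ℝ X).prod (isCompact_stdSimplex ℝ Y)).image
    (f := fun p : (X → ℝ) × (Y → ℝ) => fun z : X × Y => p.1 z.1 * p.2 z.2) (by fun_prop) using 1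
  ext v
  constructor
  · rintro ⟨q, r, hq, hr, rfl⟩
    exact ⟨(q, r), ⟨hq, hr⟩, rfl⟩
  · rintro ⟨⟨q, r⟩, ⟨hq, hr⟩, rfl⟩
    exact ⟨q, r, hq, hr, rfl⟩

lemma isClosed_mixtureHypograph (X Y : Type*) [Fintype X] [Fintype Y] (N : ℕ) :
    IsClosed (mixtureHypograph X Y N) := by
  have hK : IsCompact ((fun p : (Fin N → ℝ) × (Fin N → X × Y → ℝ) =>
      ((∑ k, p.1 k • p.2 k, ∑ k, p.1 k * shannonEntropy (p.2 k)) : (X × Y → ℝ) × ℝ)) ''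
      (stdSimplex ℝ (Fin N) ×ˢ Set.univ.pi fun _ => productPMFs X Y)) := by
    refine ((isCompact_stdSimplex ℝ _).prod
      (isCompact_univ_pi fun _ => isCompact_productPMFs X Y)).image ?_
    have := continuous_shannonEntropy (α := X × Y)
    fun_prop
  have hC : IsClosed (({0} : Set (X × Y → ℝ)) ×ˢ Set.Iic (0 : ℝ)) :=
    isClosed_singleton.prod isClosed_Iic
  convert hC.add_left_of_isCompact hK using 1
  ext ⟨v, s⟩
  rw [Set.mem_add]
  constructor
  · rintro ⟨w, u, hw, hw1, hu, hsum, hent⟩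
    refine ⟨_, ⟨(w, u), ⟨⟨hw, hw1⟩, fun k _ => hu k⟩, rfl⟩,
      (0, s - ∑ k, w k * shannonEntropy (u k)), ⟨rfl, ?_⟩, ?_⟩
    · simpa using hent
    · simpa using hsum
  · rintro ⟨_, ⟨⟨w, u⟩, ⟨⟨hw, hw1⟩, hu⟩, rfl⟩, ⟨v', s'⟩, ⟨hv', hs'⟩, h⟩
    simp only [Set.mem_singleton_iff, Set.mem_Iic, Prod.mk_add_mk, Prod.mk.injEq] at hv' hs' h
    subst hv'
    refine ⟨w, u, hw, hw1, fun k => hu k trivial, by simpa using h.1, ?_⟩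
    linarith [h.2]

lemma single_mem_productPMFs {X Y : Type*} [Fintype X] [Fintype Y] [DecidableEq X] [DecidableEq Y]
    (z : X × Y) : (Pi.single z 1 : X × Y → ℝ) ∈ productPMFs X Y := by
  refine ⟨Pi.single z.1 1, Pi.single z.2 1, ⟨fun a => ?_, by simp⟩, ⟨fun a => ?_, by simp⟩, ?_⟩
  · rw [Pi.single_apply]; split_ifs <;> norm_num
  · rw [Pi.single_apply]; split_ifs <;> norm_num
  · ext ⟨x, y⟩
    simp only [Pi.single_apply, Prod.ext_iff]
    split_ifs <;> simp_all

/-- Every distribution is a mixture of point masses. -/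
lemma exists_mem_mixtureHypograph {X Y : Type*} [Fintype X] [Fintype Y] {π : X × Y → ℝ}
    (hπ : IsPMF π) :
    ∃ s₀, ∀ s ≤ s₀, (π, s) ∈ mixtureHypograph X Y (Fintype.card X * Fintype.card Y) := by
  classical
  let e : Fin (Fintype.card X * Fintype.card Y) ≃ X × Y :=
    (Fintype.equivFinOfCardEq (Fintype.card_prod X Y)).symm
  refine ⟨_, fun s hs => ⟨fun k => π (e k), fun k => Pi.single (e k) 1, fun k => hπ.1 _, ?_,
    fun k => single_mem_productPMFs _, ?_, hs⟩⟩
  · rw [e.sum_comp π, hπ.2]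
  · rw [e.sum_comp fun z => π z • (Pi.single z 1 : X × Y → ℝ)]
    ext z
    simp [Pi.single_apply]

/-- Lagrange dual form of a strict lower bound on Wyner's common information. -/
lemma exists_entropy_multiplier {X Y : Type*} [Fintype X] [Fintype Y] {π : X × Y → ℝ}
    (hπ : IsPMF π) {R : ℝ} (hR : R < CWyner π) :
    ∃ l : X × Y → ℝ, (∀ v ∈ productPMFs X Y, shannonEntropy v ≤ ∑ z, v z * l z) ∧
      R < shannonEntropy π - ∑ z, π z * l z := by
  classical
  have hnot : (π, shannonEntropy π - R) ∉
      mixtureHypograph X Y (Fintype.card X * Fintype.card Y) := by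
    rintro ⟨w, u, hw, -, hu, hsum, hent⟩
    have := CWyner_le_sub hπ w u hw hu hsum
    simp only at hent
    linarith
  obtain ⟨f, b, hf, hb⟩ := geometric_hahn_banach_closed_point (convex_mixtureHypograph X Y)
    (isClosed_mixtureHypograph X Y _) hnot
  set c := f (0, 1) with hc
  set a : X × Y → ℝ := fun z => f (Pi.single z 1, 0) with ha
  have hfv : ∀ v s, f (v, s) = ∑ z, v z * a z + c * s := fun v s => by
    have h1 : ((v, s) : (X × Y → ℝ) × ℝ) =
        ∑ z, v z • ((Pi.single z 1, 0) : (X × Y → ℝ) × ℝ) + s • (0, 1) := by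
      ext z
      · simp [Prod.fst_sum, Finset.sum_apply, Pi.single_apply]
      · simp [Prod.snd_sum]
    rw [h1, map_add, map_sum, map_smul]
    simp only [map_smul, smul_eq_mul, ha, hc]
    ring
  have hc0 : 0 < c := by
    obtain ⟨s₀, hs₀⟩ := exists_mem_mixtureHypograph hπ
    have h1 := (hf _ (hs₀ (min s₀ (shannonEntropy π - R - 1)) (min_le_left _ _))).trans hb
    rw [hfv, hfv] at h1
    have h2 := min_le_right s₀ (shannonEntropy π - R - 1)
    nlinarith
  have hl : ∀ v : X × Y → ℝ, ∑ z, v z = 1 →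
      ∑ z, v z * ((b - a z) / c) = (b - ∑ z, v z * a z) / c := fun v hv => by
    rw [sub_div, Finset.sum_div, ← mul_one (b / c), ← hv, Finset.mul_sum, ← Finset.sum_sub_distrib]
    exact Finset.sum_congr rfl fun z _ => by ring
  refine ⟨fun z => (b - a z) / c, fun v hv => ?_, ?_⟩
  · rw [hl v (isPMF_of_mem_productPMFs hv).2, le_div_iff₀ hc0]
    have hmem : (v, shannonEntropy v) ∈
        mixtureHypograph X Y (Fintype.card X * Fintype.card Y) := by
      have hpos : 0 < Fintype.card X * Fintype.card Y := by
        rw [← Fintype.card_prod, Fintype.card_pos_iff]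
        by_contra hne
        rw [not_nonempty_iff] at hne
        simpa using hπ.2
      let k₀ : Fin (Fintype.card X * Fintype.card Y) := ⟨0, hpos⟩
      exact ⟨Pi.single k₀ 1, fun _ => v,
        fun k => by rw [Pi.single_apply]; split_ifs <;> norm_num, by simp, fun _ => hv,
        by simp [← Finset.sum_smul], by simp [← Finset.sum_mul]⟩
    have := hf _ hmem
    rw [hfv] at this
    linarith
  · rw [hl π hπ.2]
    rw [hfv] at hb
    have : (b - ∑ z, π z * a z) / c < shannonEntropy π - R := by
      rw [div_lt_iff₀ hc0]; linarith
    linarith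

lemma exp_le_one_add_add_sq_mul_exp_abs (u : ℝ) :
    Real.exp u ≤ 1 + u + u ^ 2 * Real.exp |u| := by
  have h1 : Real.exp u ≤ 1 + u * Real.exp u := by
    have h := Real.add_one_le_exp (-u)
    have h2 := mul_le_mul_of_nonneg_right h (Real.exp_pos u).le
    rw [← Real.exp_add, neg_add_cancel, Real.exp_zero] at h2
    linarith
  rcases le_total 0 u with hu | hu
  · rw [abs_of_nonneg hu]
    nlinarith
  · have h2 := Real.add_one_le_exp u
    have h3 : 1 ≤ Real.exp |u| := Real.one_le_exp (abs_nonneg u)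
    nlinarith [sq_nonneg u]

lemma rpow_one_sub_mul_exp_le {v s l : ℝ} (hv0 : 0 ≤ v) (hv1 : v ≤ 1) (hs0 : 0 < s)
    (hs : s ≤ 1 / 2) :
    v ^ (1 - s) * Real.exp (-(s * l)) ≤
      v + s * (Real.negMulLog v - v * l) + s ^ 2 * (8 * Real.exp |l|) := by
  rcases hv0.eq_or_lt with rfl | hv
  · rw [Real.zero_rpow (by linarith)]
    simp only [Real.negMulLog_zero, zero_mul, sub_zero, mul_zero, add_zero, zero_add]
    positivity
  set y := -Real.log v + |l| with hy
  have hlog : 0 ≤ -Real.log v := by linarith [Real.log_nonpos hv0 hv1]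
  have hy0 : 0 ≤ y := add_nonneg hlog (abs_nonneg l)
  set u := s * (-Real.log v - l) with hu
  have habs : |-Real.log v - l| ≤ y := by
    refine (abs_sub _ _).trans ?_
    rw [abs_of_nonneg hlog]
  have huy : |u| ≤ y / 2 := by
    rw [hu, abs_mul, abs_of_pos hs0]
    nlinarith [abs_nonneg (-Real.log v - l)]
  have hu2 : u ^ 2 ≤ s ^ 2 * y ^ 2 := by
    rw [hu, mul_pow]
    gcongr 1
    rw [← sq_abs]
    gcongr
  have hlhs : v ^ (1 - s) * Real.exp (-(s * l)) = v * Real.exp u := by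
    rw [Real.rpow_def_of_pos hv, ← Real.exp_add]
    nth_rewrite 2 [← Real.exp_log hv]
    rw [← Real.exp_add, hu]
    ring_nf
  have hv_eq : v = Real.exp (|l| - y) := by
    rw [hy]; ring_nf; exact (Real.exp_log hv).symm
  have hquad : y ^ 2 ≤ 8 * Real.exp (y / 2) := by
    have := Real.quadratic_le_exp_of_nonneg (x := y / 2) (by linarith)
    nlinarith
  have hrem : v * (u ^ 2 * Real.exp |u|) ≤ s ^ 2 * (8 * Real.exp |l|) := by
    calc v * (u ^ 2 * Real.exp |u|)
        ≤ v * ((s ^ 2 * (8 * Real.exp (y / 2))) * Real.exp (y / 2)) := by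
          gcongr
          exact hu2.trans (by gcongr)
      _ = s ^ 2 * (8 * (Real.exp (|l| - y) * Real.exp (y / 2) * Real.exp (y / 2))) := by
          rw [← hv_eq]; ring
      _ = s ^ 2 * (8 * Real.exp |l|) := by
          rw [← Real.exp_add, ← Real.exp_add]; ring_nf
  rw [hlhs]
  have h := mul_le_mul_of_nonneg_left (exp_le_one_add_add_sq_mul_exp_abs u) hv0
  have : v * u = s * (Real.negMulLog v - v * l) := by rw [hu, Real.negMulLog]; ring
  linarith

/-- Small-order tilting of the entropy bound: a first-order expansion uniform over product
distributions. -/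
lemma eventually_sum_rpow_le_exp {X Y : Type*} [Fintype X] [Fintype Y] {l : X × Y → ℝ}
    (hl : ∀ v ∈ productPMFs X Y, shannonEntropy v ≤ ∑ z, v z * l z) {δ : ℝ} (hδ : 0 < δ) :
    ∀ᶠ s in nhdsWithin (0 : ℝ) (Set.Ioi 0), ∀ v ∈ productPMFs X Y,
      ∑ z, v z ^ (1 - s) * Real.exp (-(s * l z)) ≤ Real.exp (δ * s) := by
  set C := ∑ z, 8 * Real.exp |l z| with hC
  have hC0 : 0 ≤ C := Finset.sum_nonneg fun z _ => by positivity
  have hs₀ : 0 < min (1 / 2) (δ / (C + 1)) := by positivity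
  filter_upwards [Ioc_mem_nhdsGT hs₀] with s hs v hv
  have hs1 := hs.2.trans (min_le_left _ _)
  have hs2 := hs.2.trans (min_le_right _ _)
  rw [le_div_iff₀ (by positivity)] at hs2
  have hpmf := isPMF_of_mem_productPMFs hv
  have hent := hl v hv
  calc ∑ z, v z ^ (1 - s) * Real.exp (-(s * l z))
      ≤ ∑ z, (v z + s * (Real.negMulLog (v z) - v z * l z) + s ^ 2 * (8 * Real.exp |l z|)) :=
        Finset.sum_le_sum fun z _ => rpow_one_sub_mul_exp_le (hpmf.1 z) (hpmf.le_one z) hs.1 hs1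
    _ = 1 + s * (shannonEntropy v - ∑ z, v z * l z) + s ^ 2 * C := by
        rw [Finset.sum_add_distrib, Finset.sum_add_distrib, hpmf.2, ← Finset.mul_sum,
          ← Finset.mul_sum, Finset.sum_sub_distrib, shannonEntropy]
    _ ≤ 1 + δ * s := by
        have h1 : s * (shannonEntropy v - ∑ z, v z * l z) ≤ 0 :=
          mul_nonpos_of_nonneg_of_nonpos hs.1.le (by linarith)
        nlinarith [hs.1]
    _ ≤ Real.exp (δ * s) := by linarith [Real.add_one_le_exp (δ * s)]

lemma sum_rpow_mul_rpow_le_of_productPMFs {X Y : Type*} [Fintype X] [Fintype Y] {K : X × Y → ℝ}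
    {s Φ : ℝ} (hs : s < 1) (hK : ∀ v ∈ productPMFs X Y, ∑ z, v z ^ (1 - s) * K z ≤ Φ)
    {q : X → ℝ} {r : Y → ℝ} (hq : ∀ x, 0 ≤ q x) (hr : ∀ y, 0 ≤ r y) :
    ∑ x, ∑ y, q x ^ (1 - s) * r y ^ (1 - s) * K (x, y) ≤
      Φ * ((∑ x, q x) ^ (1 - s) * (∑ y, r y) ^ (1 - s)) := by
  have h1s : (1 - s) ≠ 0 := by linarith
  have hq0 : 0 ≤ ∑ x, q x := Finset.sum_nonneg fun x _ => hq x
  have hr0 : 0 ≤ ∑ y, r y := Finset.sum_nonneg fun y _ => hr y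
  rcases hq0.eq_or_lt with h | hqpos
  · have : ∀ x, q x = 0 := fun x =>
      (Finset.sum_eq_zero_iff_of_nonneg fun x _ => hq x).1 h.symm x (Finset.mem_univ x)
    simp [this, Real.zero_rpow h1s]
  rcases hr0.eq_or_lt with h | hrpos
  · have : ∀ y, r y = 0 := fun y =>
      (Finset.sum_eq_zero_iff_of_nonneg fun y _ => hr y).1 h.symm y (Finset.mem_univ y)
    simp [this, Real.zero_rpow h1s]
  set a := ∑ x, q x with ha
  set b := ∑ y, r y with hb
  have hv : (fun z : X × Y => (q z.1 / a) * (r z.2 / b)) ∈ productPMFs X Y :=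
    ⟨fun x => q x / a, fun y => r y / b,
      ⟨fun x => div_nonneg (hq x) hq0, by rw [← Finset.sum_div, ← ha, div_self hqpos.ne']⟩,
      ⟨fun y => div_nonneg (hr y) hr0, by rw [← Finset.sum_div, ← hb, div_self hrpos.ne']⟩, rfl⟩
  have h := mul_le_mul_of_nonneg_right (hK _ hv)
    (mul_nonneg (Real.rpow_nonneg hq0 (1 - s)) (Real.rpow_nonneg hr0 (1 - s)))
  refine le_trans (le_of_eq ?_) h
  rw [Fintype.sum_prod_type, Finset.sum_mul]
  refine Finset.sum_congr rfl fun x _ => ?_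
  rw [Finset.sum_mul]
  refine Finset.sum_congr rfl fun y _ => ?_
  have ha' := (Real.rpow_pos_of_pos hqpos (1 - s)).ne'
  have hb' := (Real.rpow_pos_of_pos hrpos (1 - s)).ne'
  rw [Real.mul_rpow (div_nonneg (hq x) hq0) (div_nonneg (hr y) hr0),
    Real.div_rpow (hq x) hq0, Real.div_rpow (hr y) hr0]
  field_simp

lemma sum_fin_succ_fun {X : Type*} [Fintype X] {n : ℕ} (F : (Fin (n + 1) → X) → ℝ) :
    ∑ x, F x = ∑ a : X, ∑ x : Fin n → X, F (Fin.cons a x) := by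
  rw [← (Fin.consEquiv fun _ => X).sum_comp, Fintype.sum_prod_type]
  rfl

/-- Bilinear bounds with exponents `1 - s` tensorize. -/
lemma sum_rpow_mul_rpow_mul_prod_le {X Y : Type*} [Fintype X] [Fintype Y] {K : X × Y → ℝ}
    {s Φ : ℝ} (hΦ : 0 ≤ Φ) (hK0 : ∀ z, 0 ≤ K z)
    (hK : ∀ (q : X → ℝ) (r : Y → ℝ), (∀ x, 0 ≤ q x) → (∀ y, 0 ≤ r y) →
      ∑ x, ∑ y, q x ^ (1 - s) * r y ^ (1 - s) * K (x, y) ≤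
        Φ * ((∑ x, q x) ^ (1 - s) * (∑ y, r y) ^ (1 - s)))
    (n : ℕ) (f : (Fin n → X) → ℝ) (g : (Fin n → Y) → ℝ) (hf : ∀ x, 0 ≤ f x) (hg : ∀ y, 0 ≤ g y) :
    ∑ x, ∑ y, f x ^ (1 - s) * g y ^ (1 - s) * ∏ i, K (x i, y i) ≤
      Φ ^ n * ((∑ x, f x) ^ (1 - s) * (∑ y, g y) ^ (1 - s)) := by
  induction n with
  | zero => simp
  | succ n ih =>
    calc ∑ x, ∑ y, f x ^ (1 - s) * g y ^ (1 - s) * ∏ i, K (x i, y i)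
        = ∑ a, ∑ b, K (a, b) * ∑ x : Fin n → X, ∑ y : Fin n → Y,
            f (Fin.cons a x) ^ (1 - s) * g (Fin.cons b y) ^ (1 - s) * ∏ i, K (x i, y i) := by
          rw [sum_fin_succ_fun]
          refine Finset.sum_congr rfl fun a _ => ?_
          simp only [sum_fin_succ_fun (X := Y)]
          rw [Finset.sum_comm]
          refine Finset.sum_congr rfl fun b _ => ?_
          simp only [Finset.mul_sum, Fin.prod_univ_succ, Fin.cons_zero, Fin.cons_succ]
          exact Finset.sum_congr rfl fun x _ => Finset.sum_congr rfl fun y _ => by ring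
      _ ≤ ∑ a, ∑ b, K (a, b) * (Φ ^ n * ((∑ x : Fin n → X, f (Fin.cons a x)) ^ (1 - s) *
            (∑ y : Fin n → Y, g (Fin.cons b y)) ^ (1 - s))) :=
          Finset.sum_le_sum fun a _ => Finset.sum_le_sum fun b _ =>
            mul_le_mul_of_nonneg_left (ih _ _ (fun x => hf _) fun y => hg _) (hK0 _)
      _ = Φ ^ n * ∑ a, ∑ b, (∑ x : Fin n → X, f (Fin.cons a x)) ^ (1 - s) *
            (∑ y : Fin n → Y, g (Fin.cons b y)) ^ (1 - s) * K (a, b) := by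
          simp only [Finset.mul_sum]
          exact Finset.sum_congr rfl fun x _ => Finset.sum_congr rfl fun y _ => by ring
      _ ≤ Φ ^ n * (Φ * ((∑ a, ∑ x : Fin n → X, f (Fin.cons a x)) ^ (1 - s) *
            (∑ b, ∑ y : Fin n → Y, g (Fin.cons b y)) ^ (1 - s))) :=
          mul_le_mul_of_nonneg_left (hK _ _ (fun a => Finset.sum_nonneg fun x _ => hf _)
            fun b => Finset.sum_nonneg fun y _ => hg _) (pow_nonneg hΦ n)
      _ = Φ ^ (n + 1) * ((∑ x, f x) ^ (1 - s) * (∑ y, g y) ^ (1 - s)) := by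
          rw [sum_fin_succ_fun f, sum_fin_succ_fun g, pow_succ]; ring

/-- A Chernoff bound in the small-parameter regime. -/
lemma eventually_sum_mul_rpow_lt_one {α : Type*} [Fintype α] {π a : α → ℝ} (hπ : IsPMF π)
    (ha : ∀ z, 0 < π z → 0 < a z) (hlog : ∑ z, π z * Real.log (a z) < 0) :
    ∀ᶠ s in nhdsWithin (0 : ℝ) (Set.Ioi 0), ∑ z, π z * a z ^ s < 1 := by
  have hderiv : HasDerivAt (fun s : ℝ => ∑ z, π z * a z ^ s) (∑ z, π z * Real.log (a z)) 0 := by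
    refine HasDerivAt.fun_sum fun z _ => ?_
    rcases (hπ.1 z).eq_or_lt with h | h
    · simpa [← h] using hasDerivAt_const (0 : ℝ) (0 : ℝ)
    · have := ((hasDerivAt_id (0 : ℝ)).const_rpow (ha z h)).const_mul (π z)
      simpa using this
  have hslope := (hasDerivAt_iff_tendsto_slope.1 hderiv).eventually_lt_const hlog
  have h2 := hslope.filter_mono (nhdsWithin_mono 0 fun x (hx : x ∈ Set.Ioi 0) => ne_of_gt hx)
  filter_upwards [h2, self_mem_nhdsWithin] with s hs hs0
  have hs0' : (0 : ℝ) < s := hs0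
  rw [slope_def_field, div_lt_iff₀ (by linarith)] at hs
  simp only [Real.rpow_zero, mul_one, hπ.2] at hs
  linarith

lemma tvDist_eq_one_sub_sum_min {α : Type*} [Fintype α] {P Q : α → ℝ} (hP : IsPMF P)
    (hQ : IsPMF Q) : tvDist P Q = 1 - ∑ a, min (P a) (Q a) := by
  have h : ∀ a, |P a - Q a| = P a + Q a - 2 * min (P a) (Q a) := fun a => by
    rcases le_total (P a) (Q a) with h | h
    · rw [min_eq_left h, abs_of_nonpos (by linarith)]; ring
    · rw [min_eq_right h, abs_of_nonneg (by linarith)]; ring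
  unfold tvDist
  rw [Finset.sum_congr rfl fun a _ => h a, Finset.sum_sub_distrib, Finset.sum_add_distrib, hP.2,
    hQ.2, ← Finset.mul_sum]
  ring

lemma sum_prod_fin_eq_pow {X Y : Type*} [Fintype X] [Fintype Y] (F : X × Y → ℝ) (n : ℕ) :
    ∑ z : (Fin n → X) × (Fin n → Y), ∏ i, F (z.1 i, z.2 i) = (∑ z, F z) ^ n := by
  rw [Fintype.sum_pow, ← (Equiv.arrowProdEquivProdArrow (Fin n) (fun _ => X) fun _ => Y).sum_comp]
  rfl

lemma isPMF_prodDist {X Y : Type*} [Fintype X] [Fintype Y] {π : X × Y → ℝ} (hπ : IsPMF π)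
    (n : ℕ) : IsPMF (prodDist π n) := by
  refine ⟨fun z => Finset.prod_nonneg fun i _ => hπ.1 _, ?_⟩
  unfold prodDist
  rw [sum_prod_fin_eq_pow, hπ.2, one_pow]

lemma SynthCode.isPMF_induced {X Y : Type*} [Fintype X] [Fintype Y] {M n : ℕ} (hM : 0 < M)
    (c : SynthCode X Y M n) : IsPMF c.induced := by
  refine ⟨fun z => mul_nonneg (by positivity) (Finset.sum_nonneg fun m _ =>
    mul_nonneg ((c.PX_pmf m).1 _) ((c.PY_pmf m).1 _)), ?_⟩
  unfold SynthCode.induced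
  rw [← Finset.mul_sum, Finset.sum_comm]
  have h : ∀ m, ∑ z : (Fin n → X) × (Fin n → Y), c.PX m z.1 * c.PY m z.2 = 1 := fun m =>
    (isPMF_of_mem_productPMFs ⟨_, _, c.PX_pmf m, c.PY_pmf m, rfl⟩).2
  have hM' : (M : ℝ) ≠ 0 := by exact_mod_cast hM.ne'
  simp [h, hM']

lemma numMsgs_pos (R : ℝ) (n : ℕ) : 0 < numMsgs R n := Nat.ceil_pos.2 (Real.exp_pos _)

lemma numMsgs_le {R : ℝ} (hR : 0 ≤ R) (n : ℕ) : (numMsgs R n : ℝ) ≤ 2 * Real.exp (n * R) := by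
  have h1 := Nat.ceil_lt_add_one (Real.exp_pos (n * R)).le
  have h2 : 1 ≤ Real.exp (n * R) := Real.one_le_exp (by positivity)
  unfold numMsgs
  linarith

/-- Pointwise bound on the overlap of a uniform mixture with a target: either the target is much
smaller than the mixture, or it is atypical, or every component is small. -/
lemma min_average_le {M : ℕ} (hM : 0 < M) {p : Fin M → ℝ} (hp : ∀ m, 0 ≤ p m)
    {Q r d L s : ℝ} (hQ : 0 ≤ Q) (hs0 : 0 < s) (hs1 : s < 1) (hMr : (M : ℝ) ≤ 2 * Real.exp r) :
    min ((M : ℝ)⁻¹ * ∑ m, p m) Q ≤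
      Real.exp (-d) * ((M : ℝ)⁻¹ * ∑ m, p m) + Q * (Real.exp (r + 3 * d) * Q * Real.exp L) ^ s +
        2 * Real.exp (-(2 * d * s)) *
          ((M : ℝ)⁻¹ * ∑ m, p m ^ (1 - s) * Real.exp (-(s * L))) := by
  have hM0 : (0 : ℝ) < M := by exact_mod_cast hM
  set P := (M : ℝ)⁻¹ * ∑ m, p m with hP
  have hP0 : 0 ≤ P := mul_nonneg (by positivity) (Finset.sum_nonneg fun m _ => hp m)
  have t1 : 0 ≤ Real.exp (-d) * P := by positivity
  have t2 : 0 ≤ Q * (Real.exp (r + 3 * d) * Q * Real.exp L) ^ s := by positivity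
  have t3 : 0 ≤ 2 * Real.exp (-(2 * d * s)) *
      ((M : ℝ)⁻¹ * ∑ m, p m ^ (1 - s) * Real.exp (-(s * L))) := by
    have : 0 ≤ ∑ m, p m ^ (1 - s) * Real.exp (-(s * L)) := Finset.sum_nonneg fun m _ =>
      mul_nonneg (Real.rpow_nonneg (hp m) _) (Real.exp_pos _).le
    positivity
  by_cases hA : Q ≤ Real.exp (-d) * P
  · linarith [min_le_right P Q]
  by_cases hB : 1 ≤ Real.exp (r + 3 * d) * Q * Real.exp L
  · have := mul_le_mul_of_nonneg_left (Real.one_le_rpow hB hs0.le) hQ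
    linarith [min_le_right P Q]
  push Not at hA hB
  have hPQ : P ≤ Real.exp d * Q := by
    have h := mul_le_mul_of_nonneg_left hA.le (Real.exp_pos d).le
    rwa [← mul_assoc, ← Real.exp_add, add_neg_cancel, Real.exp_zero, one_mul] at h
  have hQL : Q ≤ Real.exp (-(r + 3 * d + L)) := by
    have h : Real.exp (r + 3 * d + L) * Q ≤ 1 := by rw [Real.exp_add]; linarith
    rw [Real.exp_neg, ← one_div, le_div_iff₀ (Real.exp_pos _)]
    linarith
  have hpm : ∀ m, p m ≤ 2 * Real.exp (-(2 * d + L)) := fun m => by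
    calc p m ≤ ∑ m, p m := Finset.single_le_sum (fun m _ => hp m) (Finset.mem_univ m)
      _ = M * P := by rw [hP]; field_simp
      _ ≤ (2 * Real.exp r) * (Real.exp d * Real.exp (-(r + 3 * d + L))) := by
          gcongr
          exact hPQ.trans (by gcongr)
      _ = 2 * Real.exp (-(2 * d + L)) := by
          rw [mul_assoc, ← Real.exp_add, ← Real.exp_add]; ring_nf
  have hpm' : ∀ m, p m ≤
      2 * Real.exp (-(2 * d * s)) * (p m ^ (1 - s) * Real.exp (-(s * L))) := fun m => by
    calc p m = p m ^ (1 - s) * p m ^ s := by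
          rw [← Real.rpow_add_of_nonneg (hp m) (by linarith) hs0.le, sub_add_cancel, Real.rpow_one]
      _ ≤ p m ^ (1 - s) * (2 * Real.exp (-(2 * d + L))) ^ s :=
          mul_le_mul_of_nonneg_left (Real.rpow_le_rpow (hp m) (hpm m) hs0.le)
            (Real.rpow_nonneg (hp m) _)
      _ ≤ p m ^ (1 - s) * (2 * Real.exp (-(2 * d + L) * s)) := by
          rw [Real.mul_rpow (by norm_num) (Real.exp_pos _).le, ← Real.exp_mul]
          have : (2 : ℝ) ^ s ≤ 2 := by
            simpa using Real.rpow_le_rpow_of_exponent_le (x := 2) (by norm_num) hs1.le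
          have h0 := Real.rpow_nonneg (hp m) (1 - s)
          gcongr
      _ = 2 * Real.exp (-(2 * d * s)) * (p m ^ (1 - s) * Real.exp (-(s * L))) := by
          rw [show -(2 * d + L) * s = -(2 * d * s) + -(s * L) by ring, Real.exp_add]; ring
  have : P ≤ 2 * Real.exp (-(2 * d * s)) *
      ((M : ℝ)⁻¹ * ∑ m, p m ^ (1 - s) * Real.exp (-(s * L))) := by
    rw [mul_left_comm, Finset.mul_sum, hP]
    gcongr
    exact hpm' _
  linarith [min_le_left P Q]

lemma SynthCode.sum_min_induced_prodDist_le {X Y : Type*} [Fintype X] [Fintype Y]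
    {π l : X × Y → ℝ} (hπ : IsPMF π) {R δ s : ℝ} (hR : 0 ≤ R) (hs0 : 0 < s) (hs1 : s < 1)
    (hl : ∀ v ∈ productPMFs X Y, ∑ z, v z ^ (1 - s) * Real.exp (-(s * l z)) ≤ Real.exp (δ * s))
    {n : ℕ} (c : SynthCode X Y (numMsgs R n) n) :
    ∑ z, min (c.induced z) (prodDist π n z) ≤ Real.exp (-(δ * n)) +
      (∑ z, π z * (Real.exp (R + 3 * δ) * π z * Real.exp (l z)) ^ s) ^ n +
        2 * Real.exp (-(δ * s * n)) := by
  have hM := numMsgs_pos R n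
  set L : (Fin n → X) × (Fin n → Y) → ℝ := fun z => ∑ i, l (z.1 i, z.2 i) with hL
  have hexp : ∀ z, ∏ i, Real.exp (-(s * l (z.1 i, z.2 i))) = Real.exp (-(s * L z)) := fun z => by
    rw [← Real.exp_sum, hL, Finset.mul_sum, Finset.sum_neg_distrib]
  have hpt := fun z => min_average_le hM (p := fun m => c.PX m z.1 * c.PY m z.2)
    (fun m => mul_nonneg ((c.PX_pmf m).1 _) ((c.PY_pmf m).1 _)) (d := δ * n) (L := L z)
    ((isPMF_prodDist hπ n).1 z) hs0 hs1 (numMsgs_le hR n)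
  refine (Finset.sum_le_sum fun z _ => hpt z).trans ?_
  rw [Finset.sum_add_distrib, Finset.sum_add_distrib,
    ← Finset.mul_sum _ _ (Real.exp (-(δ * n))),
    ← Finset.mul_sum _ _ (2 * Real.exp (-(2 * (δ * n) * s)))]
  have h1 : ∑ z : (Fin n → X) × (Fin n → Y),
      ((numMsgs R n : ℝ)⁻¹ * ∑ m, c.PX m z.1 * c.PY m z.2) = 1 := (c.isPMF_induced hM).2
  have h2 : ∑ z, prodDist π n z *
      (Real.exp (n * R + 3 * (δ * n)) * prodDist π n z * Real.exp (L z)) ^ s =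
      (∑ z, π z * (Real.exp (R + 3 * δ) * π z * Real.exp (l z)) ^ s) ^ n := by
    rw [← sum_prod_fin_eq_pow]
    refine Finset.sum_congr rfl fun z _ => ?_
    rw [Finset.prod_mul_distrib, Real.finsetProd_rpow _ _ fun i _ =>
      mul_nonneg (mul_nonneg (Real.exp_pos _).le (hπ.1 _)) (Real.exp_pos _).le,
      Finset.prod_mul_distrib, Finset.prod_mul_distrib, Finset.prod_const, ← Real.exp_nat_mul,
      ← Real.exp_sum, Finset.card_univ, Fintype.card_fin]
    congr 5
    ring
  have h3 : ∑ z : (Fin n → X) × (Fin n → Y), ((numMsgs R n : ℝ)⁻¹ *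
      ∑ m, (c.PX m z.1 * c.PY m z.2) ^ (1 - s) * Real.exp (-(s * L z))) ≤
      Real.exp (δ * s) ^ n := by
    rw [← Finset.mul_sum, Finset.sum_comm, inv_mul_le_iff₀ (by positivity)]
    calc ∑ m, ∑ z : (Fin n → X) × (Fin n → Y),
          (c.PX m z.1 * c.PY m z.2) ^ (1 - s) * Real.exp (-(s * L z))
        ≤ ∑ m : Fin (numMsgs R n), Real.exp (δ * s) ^ n := by
          refine Finset.sum_le_sum fun m _ => ?_
          have h := sum_rpow_mul_rpow_mul_prod_le (s := s) (Real.exp_pos (δ * s)).le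
            (K := fun z => Real.exp (-(s * l z))) (fun z => (Real.exp_pos _).le)
            (fun q r hq hr => sum_rpow_mul_rpow_le_of_productPMFs hs1 hl hq hr)
            n (c.PX m) (c.PY m) (c.PX_pmf m).1 (c.PY_pmf m).1
          rw [(c.PX_pmf m).2, (c.PY_pmf m).2, Real.one_rpow, mul_one, mul_one] at h
          refine le_trans (le_of_eq ?_) h
          rw [Fintype.sum_prod_type]
          refine Finset.sum_congr rfl fun x _ => Finset.sum_congr rfl fun y _ => ?_
          rw [Real.mul_rpow ((c.PX_pmf m).1 _) ((c.PY_pmf m).1 _), ← hexp]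
      _ = numMsgs R n * Real.exp (δ * s) ^ n := by simp
  rw [h1, h2, mul_one]
  refine add_le_add le_rfl ?_
  refine (mul_le_mul_of_nonneg_left h3 (by positivity)).trans (le_of_eq ?_)
  rw [← Real.exp_nat_mul, mul_assoc, ← Real.exp_add]
  ring_nf

/-- Exponential strong converse under total variation: for every rate
`R < C_Wyner(X;Y)` there is a constant `c > 0` such that for every sequence of
rate-`R` synthesis codes, the TV distance to the target is at least `1 − 4e^{−cn}`
for all `n`. -/
theorem tv_exponential_strong_converse
    {X Y : Type*} [Fintype X] [Fintype Y] (π : X × Y → ℝ) (hπ : IsPMF π)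
    (R : ℝ) (hR0 : 0 ≤ R) (hR : R < CWyner π) :
    ∃ γ : ℝ, 0 < γ ∧
      ∀ c : (n : ℕ) → SynthCode X Y (numMsgs R n) n, ∀ n : ℕ,
        1 - 4 * Real.exp (-(γ * n)) ≤ tvDist ((c n).induced) (prodDist π n) := by
  obtain ⟨l, hl, hgap⟩ := exists_entropy_multiplier hπ hR
  set δ := (shannonEntropy π - ∑ z, π z * l z - R) / 4 with hδ
  have hδ0 : 0 < δ := by rw [hδ]; linarith
  have hlog : ∑ z, π z * Real.log (Real.exp (R + 3 * δ) * π z * Real.exp (l z)) < 0 := by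
    have h : ∀ z, π z * Real.log (Real.exp (R + 3 * δ) * π z * Real.exp (l z)) =
        π z * (R + 3 * δ) - Real.negMulLog (π z) + π z * l z := fun z => by
      rcases (hπ.1 z).eq_or_lt with h | h
      · simp [← h]
      · rw [Real.log_mul (by positivity) (by positivity), Real.log_mul (by positivity) h.ne',
          Real.log_exp, Real.log_exp, Real.negMulLog]
        ring
    rw [Finset.sum_congr rfl fun z _ => h z, Finset.sum_add_distrib, Finset.sum_sub_distrib,
      ← Finset.sum_mul, hπ.2]
    unfold shannonEntropy at hδ
    linarith
  obtain ⟨s, hs, hE, hs0, hs1⟩ := ((eventually_sum_rpow_le_exp hl hδ0).and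
    ((eventually_sum_mul_rpow_lt_one hπ (fun z hz => by positivity) hlog).and
      (Ioo_mem_nhdsGT (one_pos (α := ℝ))))).exists
  set E := ∑ z, π z * (Real.exp (R + 3 * δ) * π z * Real.exp (l z)) ^ s with hEdef
  have hE0 : 0 ≤ E := Finset.sum_nonneg fun z _ => by have := hπ.1 z; positivity
  have hm0 : 0 < max E (1 / 2) := lt_max_of_lt_right (by norm_num)
  have hm1 : max E (1 / 2) < 1 := max_lt hE (by norm_num)
  refine ⟨min (δ * s) (-Real.log (max E (1 / 2))),
    lt_min (by positivity) (neg_pos.2 (Real.log_neg hm0 hm1)), fun c n => ?_⟩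
  set γ := min (δ * s) (-Real.log (max E (1 / 2))) with hγ
  rw [tvDist_eq_one_sub_sum_min ((c n).isPMF_induced (numMsgs_pos R n)) (isPMF_prodDist hπ n)]
  have h := (c n).sum_min_induced_prodDist_le hπ hR0 hs0 hs1 hs
  have hγs : γ ≤ δ * s := min_le_left _ _
  have hγδ : γ ≤ δ := hγs.trans (by nlinarith)
  have h1 : Real.exp (-(δ * n)) ≤ Real.exp (-(γ * n)) := by gcongr
  have h2 : Real.exp (-(δ * s * n)) ≤ Real.exp (-(γ * n)) := by gcongr
  have h3 : E ^ n ≤ Real.exp (-(γ * n)) := by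
    have : E ≤ Real.exp (-γ) := by
      refine (le_max_left E (1 / 2)).trans ?_
      rw [← Real.log_le_iff_le_exp hm0]
      linarith [min_le_right (δ * s) (-Real.log (max E (1 / 2)))]
    calc E ^ n ≤ Real.exp (-γ) ^ n := by gcongr
      _ = Real.exp (-(γ * n)) := by rw [← Real.exp_nat_mul]; ring_nf
  linarith
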